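/- arXiv:2511.15202 — 4 statements merged into one kernel-verified Lean document; each statement's English description precedes it below -/
import Mathlib

section
/- Let E be a finite-dimensional real inner product space, let f, g : E → ℝ be convex functions, and let ρ > 0. Suppose sequences (x_k), (z_k), (λ_k) in E are ADMM iterates for the consensus problem min f(x) + g(z) subject to x = z with penalty ρ, i.e. for every k: (i) −λ_k − ρ(x_{k+1} − z_k) ∈ ∂f(x_{k+1}); (ii) λ_k + ρ(x_{k+1} − z_{k+1}) ∈ ∂g(z_{k+1}); (iii) λ_{k+1} = λ_k + ρ(x_{k+1} − z_{k+1}). If x_k → x*, z_k → z* and λ_k → λ*, then x* = z*, −λ* ∈ ∂f(x*), λ* ∈ ∂g(z*), and x* minimizes f + g over E, i.e. f(x*) + g(x*) ≤ f(u) + g(u) for all u ∈ E. -/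
open RealInnerProductSpace Filter Topology

/-- `y` is a subgradient of `f` at `x`. -/
def SubgradientAt {E : Type*} [NormedAddCommGroup E] [InnerProductSpace ℝ E]
    (f : E → ℝ) (x y : E) : Prop :=
  ∀ u : E, f x + ⟪y, u - x⟫ ≤ f u

/-- The graph of the subdifferential of a continuous function is sequentially closed. -/
theorem SubgradientAt.of_tendsto {E : Type*} [NormedAddCommGroup E] [InnerProductSpace ℝ E]
    {f : E → ℝ} {x y : ℕ → E} {a b : E} (hf : ContinuousAt f a)
    (h : ∀ k, SubgradientAt f (x k) (y k))
    (hx : Tendsto x atTop (𝓝 a)) (hy : Tendsto y atTop (𝓝 b)) : SubgradientAt f a b := fun u =>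
  le_of_tendsto' ((hf.tendsto.comp hx).add (hy.inner (tendsto_const_nhds.sub hx)))
    fun k => h k u

/-- If ADMM iterates for the consensus problem `min f(x) + g(z) s.t. x = z`
converge, then the limit is primal feasible, dual feasible (KKT), and optimal. -/
theorem admm_limit_is_optimal
    {E : Type*} [NormedAddCommGroup E] [InnerProductSpace ℝ E] [FiniteDimensional ℝ E]
    (f g : E → ℝ) (hf : ConvexOn ℝ Set.univ f) (hg : ConvexOn ℝ Set.univ g)
    (ρ : ℝ) (hρ : 0 < ρ)
    (x z lam : ℕ → E)
    (h1 : ∀ k, SubgradientAt f (x (k + 1)) (-(lam k) - ρ • (x (k + 1) - z k)))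
    (h2 : ∀ k, SubgradientAt g (z (k + 1)) (lam k + ρ • (x (k + 1) - z (k + 1))))
    (h3 : ∀ k, lam (k + 1) = lam k + ρ • (x (k + 1) - z (k + 1)))
    (xs zs ls : E)
    (hx : Tendsto x atTop (𝓝 xs))
    (hz : Tendsto z atTop (𝓝 zs))
    (hl : Tendsto lam atTop (𝓝 ls)) :
    xs = zs ∧ SubgradientAt f xs (-ls) ∧ SubgradientAt g zs ls ∧
      ∀ u : E, f xs + g xs ≤ f u + g u := by
  have hx' : Tendsto (fun k => x (k + 1)) atTop (𝓝 xs) := hx.comp (tendsto_add_atTop_nat 1)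
  have hz' : Tendsto (fun k => z (k + 1)) atTop (𝓝 zs) := hz.comp (tendsto_add_atTop_nat 1)
  have hl' : Tendsto (fun k => lam (k + 1)) atTop (𝓝 ls) := hl.comp (tendsto_add_atTop_nat 1)
  have hlim : ls = ls + ρ • (xs - zs) :=
    tendsto_nhds_unique hl'
      ((hl.add ((hx'.sub hz').const_smul ρ)).congr fun k => (h3 k).symm)
  have hxz : xs = zs := by
    simpa [hρ.ne', sub_eq_zero] using hlim
  subst hxz
  have hfs : SubgradientAt f xs (-ls) := by
    refine .of_tendsto ((hf.continuousOn isOpen_univ).continuousAt univ_mem) h1 hx' ?_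
    simpa using hl.neg.sub ((hx'.sub hz).const_smul ρ)
  have hgs : SubgradientAt g xs ls := by
    refine .of_tendsto ((hg.continuousOn isOpen_univ).continuousAt univ_mem) h2 hz' ?_
    simpa using hl.add ((hx'.sub hz').const_smul ρ)
  refine ⟨rfl, hfs, hgs, fun u => ?_⟩
  have hfu := hfs u
  have hgu := hgs u
  rw [inner_neg_left] at hfu
  linarith
end

section
/- Let E be a real inner product space, let f, g : E → ℝ be functions, and suppose x_{k+1}, z_k, z_{k+1}, λ_{k+1} ∈ E satisfy λ_{k+1} ∈ ∂g(z_{k+1}) and −λ_{k+1} + s_{k+1} ∈ ∂f(x_{k+1}), where s_{k+1} = ρ(z_k − z_{k+1}) and r_{k+1} = x_{k+1} − z_{k+1}. Then for every w ∈ E, f(x_{k+1}) + g(z_{k+1}) − (f(w) + g(w)) ≤ −⟪λ_{k+1}, r_{k+1}⟫ + ⟪s_{k+1}, x_{k+1} − w⟫. -/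
open RealInnerProductSpace

/-- Objective-gap upper bound in terms of the primal residual
`r_{k+1} = x_{k+1} − z_{k+1}` and the dual residual `s_{k+1} = ρ(z_k − z_{k+1})`. -/
theorem admm_objective_gap_upper_bound
    {E : Type*} [NormedAddCommGroup E] [InnerProductSpace ℝ E]
    (f g : E → ℝ) (ρ : ℝ)
    (xk1 zk zk1 lamk1 : E)
    (hg : SubgradientAt g zk1 lamk1)
    (hf : SubgradientAt f xk1 (-lamk1 + ρ • (zk - zk1))) :
    ∀ w : E,
      f xk1 + g zk1 - (f w + g w) ≤
        -⟪lamk1, xk1 - zk1⟫ + ⟪ρ • (zk - zk1), xk1 - w⟫ := by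
  intro w
  have hgw := hg w
  have hfw := hf w
  simp only [inner_add_left, inner_neg_left, inner_sub_right] at hgw hfw ⊢
  linarith
end

section
/- Let E be a real inner product space, let f, g : E → ℝ be convex functions, ρ > 0, and let (x_k), (z_k), (λ_k) be ADMM iterates for the consensus problem min f(x) + g(z) subject to x = z with penalty ρ. Suppose (x*, λ*) satisfies −λ* ∈ ∂f(x*) and λ* ∈ ∂g(x*), and set V_0 = (1/ρ)‖λ_0 − λ*‖² + ρ‖z_0 − x*‖². Then the dual and z-sequences are bounded: for every k, ‖λ_k − λ*‖² ≤ ρ·V_0 and ‖z_k − x*‖² ≤ V_0/ρ. -/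
open RealInnerProductSpace

/-- The subdifferential is a monotone operator. -/
theorem SubgradientAt.inner_sub_nonneg {E : Type*} [NormedAddCommGroup E]
    [InnerProductSpace ℝ E] {f : E → ℝ} {x x' y y' : E}
    (h : SubgradientAt f x y) (h' : SubgradientAt f x' y') :
    0 ≤ ⟪y - y', x - x'⟫ := by
  have hx := h x'
  have hx' := h' x
  rw [← neg_sub x x', inner_neg_right] at hx
  rw [inner_sub_left]
  linarith

/-- One ADMM step, written in terms of the errors `a = λ_k - λ*`, `b = z_k - x*`,
`p = x_{k+1} - x*`, `q = z_{k+1} - x*`, does not increase the Lyapunov function. -/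
theorem admm_lyapunov_step {E : Type*} [NormedAddCommGroup E] [InnerProductSpace ℝ E]
    {ρ : ℝ} (hρ : 0 < ρ) {a b p q : E}
    (hp : 0 ≤ ⟪-a - ρ • (p - b), p⟫) (hq : 0 ≤ ⟪a + ρ • (p - q), q⟫) :
    ‖a + ρ • (p - q)‖ ^ 2 + ρ ^ 2 * ‖q‖ ^ 2 ≤ ‖a‖ ^ 2 + ρ ^ 2 * ‖b‖ ^ 2 := by
  have hpb : 0 ≤ ⟪p - b, p - b⟫ := real_inner_self_nonneg
  simp only [← real_inner_self_eq_norm_sq]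
  simp only [inner_add_left, inner_add_right, inner_sub_left, inner_sub_right, inner_neg_left,
    real_inner_smul_left, real_inner_smul_right] at hp hq hpb ⊢
  rw [real_inner_comm a p, real_inner_comm a q, real_inner_comm p q]
  rw [real_inner_comm b p] at hpb
  linear_combination 2 * ρ * hp + 2 * ρ * hq + ρ ^ 2 * hpb

/-- Boundedness of the ADMM dual and `z`-sequences: with
`V_0 = (1/ρ)‖λ_0 − λ*‖² + ρ‖z_0 − x*‖²`, one has `‖λ_k − λ*‖² ≤ ρ·V_0` and
`‖z_k − x*‖² ≤ V_0/ρ` for all `k`. -/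
theorem admm_iterates_bounded
    {E : Type*} [NormedAddCommGroup E] [InnerProductSpace ℝ E]
    (f g : E → ℝ) (hf : ConvexOn ℝ Set.univ f) (hg : ConvexOn ℝ Set.univ g)
    (ρ : ℝ) (hρ : 0 < ρ)
    (x z lam : ℕ → E)
    (h1 : ∀ k, SubgradientAt f (x (k + 1)) (-(lam k) - ρ • (x (k + 1) - z k)))
    (h2 : ∀ k, SubgradientAt g (z (k + 1)) (lam k + ρ • (x (k + 1) - z (k + 1))))
    (h3 : ∀ k, lam (k + 1) = lam k + ρ • (x (k + 1) - z (k + 1)))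
    (xs ls : E)
    (hkkt_f : SubgradientAt f xs (-ls))
    (hkkt_g : SubgradientAt g xs ls)
    (V0 : ℝ)
    (hV0 : V0 = 1 / ρ * ‖lam 0 - ls‖ ^ 2 + ρ * ‖z 0 - xs‖ ^ 2) :
    ∀ k : ℕ, ‖lam k - ls‖ ^ 2 ≤ ρ * V0 ∧ ‖z k - xs‖ ^ 2 ≤ V0 / ρ := by
  have step : ∀ k, ‖lam (k + 1) - ls‖ ^ 2 + ρ ^ 2 * ‖z (k + 1) - xs‖ ^ 2 ≤
      ‖lam k - ls‖ ^ 2 + ρ ^ 2 * ‖z k - xs‖ ^ 2 := by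
    intro k
    have hp := (h1 k).inner_sub_nonneg hkkt_f
    have hq := (h2 k).inner_sub_nonneg hkkt_g
    have key := admm_lyapunov_step hρ (a := lam k - ls) (b := z k - xs)
      (p := x (k + 1) - xs) (q := z (k + 1) - xs)
      (by convert hp using 2; module) (by convert hq using 2; module)
    rwa [sub_sub_sub_cancel_right, sub_add_eq_add_sub, ← h3 k] at key
  have bound : ∀ k, ‖lam k - ls‖ ^ 2 + ρ ^ 2 * ‖z k - xs‖ ^ 2 ≤ ρ * V0 := by
    intro k
    refine (antitone_nat_of_succ_le
      (f := fun k => ‖lam k - ls‖ ^ 2 + ρ ^ 2 * ‖z k - xs‖ ^ 2) step k.zero_le).trans_eq ?_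
    rw [hV0]
    field_simp
  intro k
  have hk := bound k
  refine ⟨by nlinarith [sq_nonneg (ρ * ‖z k - xs‖)], ?_⟩
  rw [le_div_iff₀ hρ]
  refine le_of_mul_le_mul_left ?_ hρ
  nlinarith [sq_nonneg ‖lam k - ls‖]
end

section
/- Let E be a real inner product space, let f, g : E → ℝ be convex functions, ρ > 0, and let (x_k), (z_k), (λ_k) be ADMM iterates for the consensus problem min f(x) + g(z) subject to x = z with penalty ρ. Suppose (x*, λ*) satisfies −λ* ∈ ∂f(x*) and λ* ∈ ∂g(x*). Then the objective values converge to the optimal value: f(x_{k+1}) + g(z_{k+1}) → f(x*) + g(x*) as k → ∞. -/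
open RealInnerProductSpace Filter Topology

/-- The subdifferential is a monotone operator. -/
lemma SubgradientAt.inner_sub_nonneg_s12 {E : Type*} [NormedAddCommGroup E] [InnerProductSpace ℝ E]
    {f : E → ℝ} {u v p q : E} (hp : SubgradientAt f u p) (hq : SubgradientAt f v q) :
    0 ≤ ⟪p - q, u - v⟫ := by
  have hpv := hp v
  have hqu := hq u
  simp only [inner_sub_left, inner_sub_right] at *
  linarith

/-- A nonnegative sequence dominated by the decrements of a nonnegative sequence tends to zero. -/
lemma tendsto_zero_of_add_le {V a : ℕ → ℝ} (hV : ∀ k, 0 ≤ V k) (ha : ∀ k, 0 ≤ a k)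
    (h : ∀ k, V (k + 1) + a k ≤ V k) : Tendsto a atTop (𝓝 0) := by
  have hanti : Antitone V := antitone_nat_of_succ_le fun k => by linarith [h k, ha k]
  have hlim := tendsto_atTop_ciInf hanti ⟨0, by rintro _ ⟨k, rfl⟩; exact hV k⟩
  have hdiff := hlim.sub (hlim.comp (tendsto_add_atTop_nat 1))
  rw [sub_self] at hdiff
  exact squeeze_zero ha (fun k => by simpa using le_sub_iff_add_le'.mpr (h k)) hdiff

/-- The KKT conditions bound the objective gap below by the primal residual. -/
lemma neg_inner_le_objective_gap {E : Type*} [NormedAddCommGroup E] [InnerProductSpace ℝ E]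
    {f g : E → ℝ} {xs ls : E} (hf : SubgradientAt f xs (-ls)) (hg : SubgradientAt g xs ls)
    (x z : E) : -⟪ls, x - z⟫ ≤ f x + g z - (f xs + g xs) := by
  have hfx := hf x
  have hgz := hg z
  simp only [inner_sub_right, inner_neg_left] at *
  linarith

/-- An ADMM step from `z` to `(x₁, z₁, l₁)` bounds the objective gap above. -/
lemma objective_gap_le {E : Type*} [NormedAddCommGroup E] [InnerProductSpace ℝ E]
    {f g : E → ℝ} {ρ : ℝ} {x₁ z z₁ l₁ : E}
    (hf : SubgradientAt f x₁ (-l₁ - ρ • (z₁ - z))) (hg : SubgradientAt g z₁ l₁) (u : E) :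
    f x₁ + g z₁ - (f u + g u) ≤
      -⟪l₁, x₁ - z₁⟫ - ρ * ⟪z₁ - z, (x₁ - z₁) + (z₁ - u)⟫ := by
  have hfu := hf u
  have hgu := hg u
  simp only [inner_sub_right, inner_sub_left, inner_add_right, inner_neg_left,
    real_inner_smul_left] at *
  linarith

/-- The algebraic core of the ADMM Lyapunov decrease. -/
lemma lyapunov_decrease {E : Type*} [NormedAddCommGroup E] [InnerProductSpace ℝ E]
    {ρ : ℝ} (hρ : 0 < ρ) {a r d w : E}
    (hgap : ⟪a, r⟫ + ρ * ⟪d, r + w⟫ ≤ 0) (hmono : 0 ≤ ⟪ρ • r, d⟫) :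
    ‖a‖ ^ 2 + ρ ^ 2 * ‖w‖ ^ 2 + ρ ^ 2 * (‖r‖ ^ 2 + ‖d‖ ^ 2) ≤
      ‖a - ρ • r‖ ^ 2 + ρ ^ 2 * ‖w - d‖ ^ 2 := by
  rw [norm_sub_sq_real, norm_sub_sq_real, norm_smul, mul_pow, Real.norm_eq_abs, sq_abs,
    real_inner_smul_right, real_inner_comm d w]
  rw [inner_add_right] at hgap
  rw [real_inner_smul_left, real_inner_comm d r] at hmono
  nlinarith [mul_le_mul_of_nonneg_left hgap hρ.le, mul_nonneg hρ.le hmono]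

/-- Objective convergence of ADMM: if `(x*, λ*)` satisfies the KKT conditions,
then the ADMM objective values `f(x_{k+1}) + g(z_{k+1})` converge to the optimal
value `f(x*) + g(x*)`. -/
theorem admm_objective_convergence
    {E : Type*} [NormedAddCommGroup E] [InnerProductSpace ℝ E]
    (f g : E → ℝ) (hf : ConvexOn ℝ Set.univ f) (hg : ConvexOn ℝ Set.univ g)
    (ρ : ℝ) (hρ : 0 < ρ)
    (x z lam : ℕ → E)
    (h1 : ∀ k, SubgradientAt f (x (k + 1)) (-(lam k) - ρ • (x (k + 1) - z k)))
    (h2 : ∀ k, SubgradientAt g (z (k + 1)) (lam k + ρ • (x (k + 1) - z (k + 1))))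
    (h3 : ∀ k, lam (k + 1) = lam k + ρ • (x (k + 1) - z (k + 1)))
    (xs ls : E)
    (hkkt_f : SubgradientAt f xs (-ls))
    (hkkt_g : SubgradientAt g xs ls) :
    Tendsto (fun k => f (x (k + 1)) + g (z (k + 1))) atTop (𝓝 (f xs + g xs)) := by
  have hgsub : ∀ k, SubgradientAt g (z (k + 1)) (lam (k + 1)) := fun k => h3 k ▸ h2 k
  have hfsub : ∀ k, SubgradientAt f (x (k + 1)) (-lam (k + 1) - ρ • (z (k + 1) - z k)) := by
    intro k
    convert h1 k using 1
    rw [h3 k]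
    module
  have hlow := fun k => neg_inner_le_objective_gap hkkt_f hkkt_g (x (k + 1)) (z (k + 1))
  have hupp := fun k => objective_gap_le (hfsub k) (hgsub k) xs
  let V : ℕ → ℝ := fun k => ‖lam (k + 1) - ls‖ ^ 2 + ρ ^ 2 * ‖z (k + 1) - xs‖ ^ 2
  let r : ℕ → E := fun k => x (k + 1) - z (k + 1)
  let d : ℕ → E := fun k => z (k + 1) - z k
  have hV : ∀ k, 0 ≤ V k := fun k => by positivity
  have hdec : ∀ k, V (k + 1) + ρ ^ 2 * (‖r (k + 1)‖ ^ 2 + ‖d (k + 1)‖ ^ 2) ≤ V k := by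
    intro k
    have hgap : ⟪lam (k + 2) - ls, r (k + 1)⟫
        + ρ * ⟪d (k + 1), r (k + 1) + (z (k + 2) - xs)⟫ ≤ 0 := by
      have := (hlow (k + 1)).trans (hupp (k + 1))
      rw [inner_sub_left]
      linarith
    have hlam : ρ • r (k + 1) = lam (k + 2) - lam (k + 1) := by
      rw [h3 (k + 1)]
      simp [r]
    have hmono : 0 ≤ ⟪ρ • r (k + 1), d (k + 1)⟫ :=
      hlam ▸ (hgsub (k + 1)).inner_sub_nonneg_s12 (hgsub k)
    have := lyapunov_decrease hρ hgap hmono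
    rw [hlam, sub_sub_sub_cancel_left] at this
    convert this using 3
    all_goals simp [d]
  have hres := tendsto_zero_of_add_le hV (fun k => by positivity) hdec
  have hsq : Tendsto (fun k => ‖r (k + 1)‖ ^ 2 + ‖d (k + 1)‖ ^ 2) atTop (𝓝 0) := by
    have := hres.const_mul (ρ ^ 2)⁻¹
    simpa [← mul_assoc, hρ.ne'] using this
  have htend : ∀ v : ℕ → E, (∀ k, ‖v k‖ ^ 2 ≤ ‖r (k + 1)‖ ^ 2 + ‖d (k + 1)‖ ^ 2) →
      Tendsto (fun k => ‖v k‖) atTop (𝓝 0) := by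
    intro v hv
    have := (squeeze_zero (fun k => sq_nonneg _) hv hsq).sqrt
    simpa using this
  have hr := htend (fun k => r (k + 1)) fun k => le_add_of_nonneg_right (sq_nonneg _)
  have hd := htend (fun k => d (k + 1)) fun k => le_add_of_nonneg_left (sq_nonneg _)
  have hVle : ∀ k, V k ≤ V 0 := fun k =>
    antitone_nat_of_succ_le (fun n => le_trans (le_add_of_nonneg_right (by positivity)) (hdec n))
      (Nat.zero_le k)
  set M := √(V 0)
  have hlamM : ∀ k, ‖lam (k + 1)‖ ≤ M + ‖ls‖ := by
    intro k
    have : ‖lam (k + 1) - ls‖ ≤ M :=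
      Real.le_sqrt_of_sq_le ((le_add_of_nonneg_right (by positivity)).trans (hVle k))
    linarith [norm_le_norm_sub_add (lam (k + 1)) ls]
  have hzM : ∀ k, ρ * ‖z (k + 1) - xs‖ ≤ M := fun k =>
    Real.le_sqrt_of_sq_le <| by
      rw [mul_pow]
      exact (le_add_of_nonneg_left (sq_nonneg _)).trans (hVle k)
  rw [← tendsto_add_atTop_iff_nat 1, tendsto_iff_norm_sub_tendsto_zero]
  have hbound : Tendsto (fun k => (M + ‖ls‖) * ‖r (k + 1)‖
      + ρ * (‖d (k + 1)‖ * ‖r (k + 1)‖) + M * ‖d (k + 1)‖) atTop (𝓝 0) := by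
    simpa using ((hr.const_mul (M + ‖ls‖)).add ((hd.mul hr).const_mul ρ)).add (hd.const_mul M)
  refine squeeze_zero (fun k => norm_nonneg _) (fun k => ?_) hbound
  have hM : 0 ≤ M := Real.sqrt_nonneg _
  have hdr : 0 ≤ ρ * (‖d (k + 1)‖ * ‖r (k + 1)‖) := by positivity
  have hMd : 0 ≤ M * ‖d (k + 1)‖ := by positivity
  have hMr : 0 ≤ M * ‖r (k + 1)‖ := by positivity
  rw [Real.norm_eq_abs, abs_le]
  constructor
  · have := real_inner_le_norm ls (r (k + 1))
    linarith [hlow (k + 1)]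
  · have hu := hupp (k + 1)
    rw [inner_add_right] at hu
    have hl := neg_le_of_abs_le (abs_real_inner_le_norm (lam (k + 2)) (r (k + 1)))
    have hlr := mul_le_mul_of_nonneg_right (hlamM (k + 1)) (norm_nonneg (r (k + 1)))
    have hdr_inner := mul_le_mul_of_nonneg_left
      (neg_le_of_abs_le (abs_real_inner_le_norm (d (k + 1)) (r (k + 1)))) hρ.le
    have hdz := mul_le_mul_of_nonneg_left
      (neg_le_of_abs_le (abs_real_inner_le_norm (d (k + 1)) (z (k + 2) - xs))) hρ.le
    have hzd := mul_le_mul_of_nonneg_right (hzM (k + 1)) (norm_nonneg (d (k + 1)))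
    linarith
end
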